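/- Let p > 2. There exists a positive constant c₂ (depending only on p and n) such that for all vectors x₁, x₂ in ℝⁿ one has | |x₂|^{p−2} x₂ − |x₁|^{p−2} x₁ | ≤ c₂ (|x₂| + |x₁|)^{p−2} |x₂ − x₁|, where |·| is the Euclidean norm. -/

import Mathlib

open Real

theorem Real.rpow_sub_rpow_mul_le {a b q : ℝ} (ha : 0 ≤ a) (hab : a ≤ b) (hq : 0 < q) :
    (b ^ q - a ^ q) * a ≤ (q + 1) * b ^ q * (b - a) := by
  rcases (ha.trans hab).eq_or_lt with hb | hb
  · obtain rfl : a = 0 := le_antisymm (hb ▸ hab) ha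
    simp [← hb]
  obtain ⟨t, rfl⟩ : ∃ t, a = t * b := ⟨a / b, by field_simp⟩
  have ht : 0 ≤ t := nonneg_of_mul_nonneg_left ha hb
  have ht1 : t ≤ 1 := by
    by_contra! h
    nlinarith
  have bernoulli := one_add_mul_self_le_rpow_one_add (s := t - 1) (by linarith)
    (p := q + 1) (by linarith)
  rw [add_sub_cancel, rpow_add_one' ht (by linarith)] at bernoulli
  rw [mul_rpow ht hb.le]
  have key : (1 - t ^ q) * t ≤ (q + 1) * (1 - t) := by nlinarith
  calc (b ^ q - t ^ q * b ^ q) * (t * b) = (b ^ q * b) * ((1 - t ^ q) * t) := by ring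
    _ ≤ (b ^ q * b) * ((q + 1) * (1 - t)) := by gcongr
    _ = (q + 1) * b ^ q * (b - t * b) := by ring

theorem norm_rpow_smul_sub_le_of_norm_le {E : Type*} [NormedAddCommGroup E] [NormedSpace ℝ E]
    {q : ℝ} (hq : 0 < q) {x y : E} (hxy : ‖x‖ ≤ ‖y‖) :
    ‖‖y‖ ^ q • y - ‖x‖ ^ q • x‖ ≤ (q + 2) * (‖y‖ + ‖x‖) ^ q * ‖y - x‖ := by
  have hpow : ‖x‖ ^ q ≤ ‖y‖ ^ q := by gcongr
  calc ‖‖y‖ ^ q • y - ‖x‖ ^ q • x‖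
      = ‖‖y‖ ^ q • (y - x) + (‖y‖ ^ q - ‖x‖ ^ q) • x‖ := by congr 1; module
    _ ≤ ‖y‖ ^ q * ‖y - x‖ + (‖y‖ ^ q - ‖x‖ ^ q) * ‖x‖ := by
      refine (norm_add_le _ _).trans_eq ?_
      rw [norm_smul, norm_smul, norm_of_nonneg (by positivity),
        norm_of_nonneg (sub_nonneg.2 hpow)]
    _ ≤ ‖y‖ ^ q * ‖y - x‖ + (q + 1) * ‖y‖ ^ q * (‖y‖ - ‖x‖) := by
      gcongr _ + ?_
      exact rpow_sub_rpow_mul_le (norm_nonneg x) hxy hq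
    _ ≤ ‖y‖ ^ q * ‖y - x‖ + (q + 1) * ‖y‖ ^ q * ‖y - x‖ := by
      gcongr
      exact norm_sub_norm_le y x
    _ = (q + 2) * ‖y‖ ^ q * ‖y - x‖ := by ring
    _ ≤ (q + 2) * (‖y‖ + ‖x‖) ^ q * ‖y - x‖ := by
      gcongr
      exact le_add_of_nonneg_right (norm_nonneg x)

/-- Lindqvist's inequality, part (b): local Lipschitz estimate for the p-Laplacian
vector field `x ↦ |x|^{p-2} x` for `p > 2`. -/
theorem lindqvist_lipschitz (n : ℕ) (p : ℝ) (hp : 2 < p) :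
    ∃ c₂ : ℝ, 0 < c₂ ∧ ∀ x₁ x₂ : EuclideanSpace ℝ (Fin n),
      ‖‖x₂‖ ^ (p - 2) • x₂ - ‖x₁‖ ^ (p - 2) • x₁‖
        ≤ c₂ * (‖x₂‖ + ‖x₁‖) ^ (p - 2) * ‖x₂ - x₁‖ := by
  have hq : 0 < p - 2 := sub_pos.2 hp
  refine ⟨p - 2 + 2, by linarith, fun x₁ x₂ => ?_⟩
  rcases le_total ‖x₁‖ ‖x₂‖ with h | h
  · exact norm_rpow_smul_sub_le_of_norm_le hq h
  · rw [norm_sub_rev, norm_sub_rev x₂, add_comm ‖x₂‖]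
    exact norm_rpow_smul_sub_le_of_norm_le hq h
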